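/- Let 0 ≠ L = Σ_{i=1}^N f_i ∂_{x_i} be a W-invariant vector field in D_m, and let V_f = span_ℂ⟨f_1,…,f_N⟩ ⊆ S. Then the map ψ : V* → V_f defined by ψ(ξ) = L(ξ) is a W-equivariant linear isomorphism; in particular V_f ≅ V* as W-modules. -/

import Mathlib

open MvPolynomial

noncomputable section

/-- Action of a matrix `M` on polynomials by linear substitution of the variables. -/
def polyActM {N : ℕ} (M : Matrix (Fin N) (Fin N) ℂ) (p : MvPolynomial (Fin N) ℂ) :
    MvPolynomial (Fin N) ℂ :=
  MvPolynomial.aeval (fun i => ∑ j, MvPolynomial.C (M i j) * MvPolynomial.X j) p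

/-- Action of `g ∈ GL_N(ℂ)` on polynomials: `(g · p)(x) = p (g⁻¹ x)`. -/
def polyAct {N : ℕ} (g : Matrix.GeneralLinearGroup (Fin N) ℂ) (p : MvPolynomial (Fin N) ℂ) :
    MvPolynomial (Fin N) ℂ :=
  polyActM (↑(g⁻¹) : Matrix (Fin N) (Fin N) ℂ) p

/-- The linear polynomial with coefficient vector `a`. -/
def linPoly {N : ℕ} (a : Fin N → ℂ) : MvPolynomial (Fin N) ℂ :=
  ∑ i, MvPolynomial.C (a i) * MvPolynomial.X i

/-- The polynomial vector field `L = Σ f_i ∂_i` applied to a polynomial. -/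
def applyVF {N : ℕ} (f : Fin N → MvPolynomial (Fin N) ℂ) (p : MvPolynomial (Fin N) ℂ) :
    MvPolynomial (Fin N) ℂ :=
  ∑ i, f i * MvPolynomial.pderiv i p

/-- `g` is a (complex) reflection: `g ≠ 1` and `g` fixes a hyperplane pointwise. -/
def IsReflection {N : ℕ} (g : Matrix.GeneralLinearGroup (Fin N) ℂ) : Prop :=
  ((↑g : Matrix (Fin N) (Fin N) ℂ) - 1).rank = 1

/-- A vector field applied to a linear form is a linear combination of its components. -/
lemma applyVF_linPoly {N : ℕ} (f : Fin N → MvPolynomial (Fin N) ℂ) (b : Fin N → ℂ) :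
    applyVF f (linPoly b) = ∑ i, b i • f i := by
  unfold applyVF linPoly
  refine Finset.sum_congr rfl fun i _ => ?_
  have h : pderiv i (∑ j, C (b j) * X j : MvPolynomial (Fin N) ℂ) = C (b i) := by
    simp [pderiv_X, Pi.single_apply]
  rw [h, MvPolynomial.smul_eq_C_mul, mul_comm]

/-- Substitution by `M` acts on linear forms by right multiplication of coefficient vectors. -/
lemma polyActM_linPoly {N : ℕ} (M : Matrix (Fin N) (Fin N) ℂ) (b : Fin N → ℂ) :
    polyActM M (linPoly b) = linPoly (Matrix.vecMul b M) := by
  simp only [polyActM, linPoly, map_sum, map_mul, aeval_X, Matrix.vecMul, dotProduct,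
    Finset.sum_mul, Finset.mul_sum, algHom_C, MvPolynomial.algebraMap_eq]
  rw [Finset.sum_comm]
  exact Finset.sum_congr rfl fun j _ => Finset.sum_congr rfl fun i _ => by ring

/-- A vector field invariant under `g` restricts to a `g`-equivariant map on linear forms. -/
lemma applyVF_linPoly_vecMul_inv {N : ℕ} (f : Fin N → MvPolynomial (Fin N) ℂ)
    (g : Matrix.GeneralLinearGroup (Fin N) ℂ)
    (hg : ∀ p, polyAct g (applyVF f (polyAct g⁻¹ p)) = applyVF f p) (b : Fin N → ℂ) :
    applyVF f (linPoly (Matrix.vecMul b (↑(g⁻¹) : Matrix (Fin N) (Fin N) ℂ)))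
      = polyAct g (applyVF f (linPoly b)) := by
  rw [← hg]
  congr 2
  rw [polyAct, inv_inv, polyActM_linPoly, Matrix.vecMul_vecMul, Units.inv_mul, Matrix.vecMul_one]

/-- If `W` acts irreducibly on column vectors, then a proper subspace of row vectors that is
stable under `W` is zero. -/
lemma eq_bot_of_vecMul_mem {N : ℕ} (W : Subgroup (Matrix.GeneralLinearGroup (Fin N) ℂ))
    (hirr : ∀ U : Submodule ℂ (Fin N → ℂ),
      (∀ g ∈ W, ∀ v ∈ U, (↑g : Matrix (Fin N) (Fin N) ℂ).mulVec v ∈ U) → U = ⊥ ∨ U = ⊤)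
    (K : Submodule ℂ (Fin N → ℂ))
    (hK : ∀ g ∈ W, ∀ b ∈ K, Matrix.vecMul b (↑g : Matrix (Fin N) (Fin N) ℂ) ∈ K)
    (hne : K ≠ ⊤) : K = ⊥ := by
  let U : Submodule ℂ (Fin N → ℂ) :=
    { carrier := {v | ∀ b ∈ K, b ⬝ᵥ v = 0}
      zero_mem' := fun b _ => dotProduct_zero b
      add_mem' := fun {v w} hv hw b hb => by rw [dotProduct_add, hv b hb, hw b hb, add_zero]
      smul_mem' := fun c v hv b hb => by rw [dotProduct_smul, hv b hb, smul_zero] }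
  have hU : ∀ g ∈ W, ∀ v ∈ U, (↑g : Matrix (Fin N) (Fin N) ℂ).mulVec v ∈ U := by
    intro g hg v hv b hb
    rw [Matrix.dotProduct_mulVec]
    exact hv _ (hK g hg b hb)
  rcases hirr U hU with h | h
  · obtain ⟨φ, hφ, hφK⟩ := K.exists_le_ker_of_lt_top (lt_top_iff_ne_top.mpr hne)
    have hφ_apply : ∀ b, φ b = b ⬝ᵥ fun i => φ (Pi.single i 1) := fun b => by
      have hb : b = ∑ i, b i • Pi.single i (1 : ℂ) := by
        simpa [← Pi.single_smul'] using (Finset.univ_sum_single b).symm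
      conv_lhs => rw [hb]
      simp only [map_sum, map_smul, smul_eq_mul, dotProduct]
    have hv : (fun i => φ (Pi.single i 1)) ∈ U := fun b hb => by
      rw [← hφ_apply]
      exact hφK hb
    rw [h, Submodule.mem_bot] at hv
    refine absurd (LinearMap.ext fun b => ?_) hφ
    rw [hφ_apply, hv, dotProduct_zero, LinearMap.zero_apply]
  · refine (Submodule.eq_bot_iff K).mpr fun b hb => funext fun i => ?_
    have hi : Pi.single i 1 ∈ U := h ▸ Submodule.mem_top
    simpa using hi b hb

/-- for `0 ≠ L = Σ f_i ∂_i ∈ D_m` a `W`-invariant vector field, the map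
`ψ : V* → V_f = span⟨f_1,…,f_N⟩`, `ψ(ξ) = L(ξ)`, is a `W`-equivariant linear isomorphism
onto `V_f`; in particular `V_f ≅ V*` as `W`-modules. Linear forms `ξ ∈ V*` are encoded by
their coefficient vectors `b : Fin N → ℂ`, on which `w ∈ W` acts by
`b ↦ vecMul b (w⁻¹)` (so that `(w·ξ)(v) = ξ(w⁻¹ v)`). -/
theorem stmt_4 (N : ℕ) (hN : 0 < N)
    -- the finite group `W`, generated by reflections, acting irreducibly on `V = ℂ^N`
    (W : Subgroup (Matrix.GeneralLinearGroup (Fin N) ℂ)) (hWfin : Finite W)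
    (hgen : Subgroup.closure {g | g ∈ W ∧ IsReflection g} = W)
    (hirr : ∀ U : Submodule ℂ (Fin N → ℂ),
      (∀ g ∈ W, ∀ v ∈ U, (↑g : Matrix (Fin N) (Fin N) ℂ).mulVec v ∈ U) → U = ⊥ ∨ U = ⊤)
    -- the reflection arrangement data
    (A : Type)
    (s : A → Matrix.GeneralLinearGroup (Fin N) ℂ) (hsW : ∀ H, s H ∈ W)
    (n : A → ℕ) (hn2 : ∀ H, 2 ≤ n H) (horder : ∀ H, orderOf (s H) = n H)
    (α : A → (Fin N → ℂ)) (hα : ∀ H, α H ≠ 0)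
    (αv : A → (Fin N → ℂ)) (hαv : ∀ H, αv H ≠ 0)
    (hform : ∀ H (v : Fin N → ℂ),
      (↑(s H) : Matrix (Fin N) (Fin N) ℂ).mulVec v = v - (∑ i, α H i * v i) • αv H)
    (m : A → ℕ)
    -- a nonzero `W`-invariant vector field `L = Σ f_i ∂_i` in `D_m`
    (f : Fin N → MvPolynomial (Fin N) ℂ) (hf0 : f ≠ 0)
    (hinv : ∀ g ∈ W, ∀ p : MvPolynomial (Fin N) ℂ,
      polyAct g (applyVF f (polyAct g⁻¹ p)) = applyVF f p)
    (hDm : ∀ H, linPoly (α H) ^ (m H * n H + 1) ∣ applyVF f (linPoly (α H))) :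
    Function.Injective (fun b : Fin N → ℂ => applyVF f (linPoly b)) ∧
    Set.range (fun b : Fin N → ℂ => applyVF f (linPoly b))
      = (Submodule.span ℂ (Set.range f) : Set (MvPolynomial (Fin N) ℂ)) ∧
    (∀ b b' : Fin N → ℂ,
      applyVF f (linPoly (b + b')) = applyVF f (linPoly b) + applyVF f (linPoly b')) ∧
    (∀ (c : ℂ) (b : Fin N → ℂ), applyVF f (linPoly (c • b)) = c • applyVF f (linPoly b)) ∧
    (∀ g ∈ W, ∀ b : Fin N → ℂ,
      applyVF f (linPoly (Matrix.vecMul b (↑(g⁻¹) : Matrix (Fin N) (Fin N) ℂ)))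
        = polyAct g (applyVF f (linPoly b))) := by
  have hequiv := fun g hg => applyVF_linPoly_vecMul_inv f g (hinv g hg)
  refine ⟨?_, ?_, ?_, ?_, hequiv⟩
  · have hψ : ∀ b, Fintype.linearCombination ℂ f b = applyVF f (linPoly b) := fun b => by
      rw [applyVF_linPoly, Fintype.linearCombination_apply]
    have hker : LinearMap.ker (Fintype.linearCombination ℂ f) = ⊥ := by
      refine eq_bot_of_vecMul_mem W hirr _ (fun g hg b hb => ?_) fun htop => hf0 ?_
      · rw [LinearMap.mem_ker, hψ] at hb ⊢
        have h := hequiv g⁻¹ (inv_mem hg) b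
        rwa [inv_inv, hb, polyAct, polyActM, map_zero] at h
      · rw [LinearMap.ker_eq_top] at htop
        funext i
        simpa using LinearMap.congr_fun htop (Pi.single i 1)
    have hinj := LinearMap.ker_eq_bot.mp hker
    intro b b' h
    exact hinj ((hψ b).trans (h.trans (hψ b').symm))
  · rw [← Fintype.range_linearCombination ℂ f, LinearMap.coe_range]
    congr 1
    funext b
    rw [applyVF_linPoly, Fintype.linearCombination_apply]
  · intro b b'
    simp only [applyVF_linPoly, Pi.add_apply, add_smul, Finset.sum_add_distrib]
  · intro c b
    simp only [applyVF_linPoly, Pi.smul_apply, smul_assoc, Finset.smul_sum]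

end
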